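/- arXiv:2402.03076 — 2 statements merged into one kernel-verified Lean document; each statement's English description precedes it below -/
import Mathlib

section
/- Assume every sufficiently large odd natural number is a sum of 15 fifth powers of primes outside an exceptional set E₁ with |E₁ ∩ [1,N]| ≪ N^{1 − 1/10 − 27/3200 + ε}. Then the set E₂ of even natural numbers n not representable as n = p² + p₁⁵ + ⋯ + p₁₅⁵ (all variables prime) satisfies |E₂ ∩ [1,N]| ≪ N^{1/2 − 1/10 − 27/3200 + ε} for every ε > 0. -/
open scoped Classical

/-- `n` is a sum of fifteen fifth powers of primes. -/
def Rep15 (n : ℕ) : Prop :=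
  ∃ p : Fin 15 → ℕ, (∀ i, (p i).Prime) ∧ n = ∑ i, (p i) ^ 5

/-- `n` is a sum of one square of a prime and fifteen fifth powers of primes. -/
def RepSq15 (n : ℕ) : Prop :=
  ∃ (p : ℕ) (f : Fin 15 → ℕ), p.Prime ∧ (∀ i, (f i).Prime) ∧ n = p ^ 2 + ∑ i, (f i) ^ 5

/-- The divisor bound `d(n) ≪ n ^ η`. -/
lemma exists_card_divisors_le_mul_rpow {η : ℝ} (hη : 0 < η) :
    ∃ C : ℝ, 0 < C ∧ ∀ n : ℕ, n ≠ 0 → (n.divisors.card : ℝ) ≤ C * (n : ℝ) ^ η := by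
  obtain ⟨M, hM⟩ : ∃ M : ℕ, ∀ p : ℕ, M ≤ p → (2 : ℝ) ≤ (p : ℝ) ^ η := by
    have h := ((tendsto_rpow_atTop hη).comp tendsto_natCast_atTop_atTop).eventually_ge_atTop
      (2 : ℝ)
    exact Filter.eventually_atTop.1 h
  have hlog : 0 < Real.log 2 := Real.log_pos one_lt_two
  set K : ℝ := 1 + 1 / (η * Real.log 2) with hK
  have hK1 : 1 ≤ K := le_add_of_nonneg_right (by positivity)
  have key : ∀ p a : ℕ, p.Prime →
      ((a + 1 : ℕ) : ℝ) ≤ (if p < M then K else 1) * ((p ^ a : ℕ) : ℝ) ^ η := by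
    intro p a hp
    have hpow : ((p ^ a : ℕ) : ℝ) ^ η = ((p : ℝ) ^ η) ^ a := by
      push_cast
      rw [← Real.rpow_natCast, ← Real.rpow_natCast, ← Real.rpow_mul (by positivity),
        ← Real.rpow_mul (by positivity), mul_comm]
    rw [hpow]
    split_ifs with h
    · have h2 : (2 : ℝ) ^ η ≤ (p : ℝ) ^ η :=
        Real.rpow_le_rpow (by norm_num) (by exact_mod_cast hp.two_le) hη.le
      have h3 : 1 + η * Real.log 2 ≤ (2 : ℝ) ^ η := by
        rw [Real.rpow_def_of_pos two_pos, mul_comm η]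
        linarith [Real.add_one_le_exp (Real.log 2 * η)]
      have h4 : 1 + (a : ℝ) * (η * Real.log 2) ≤ ((p : ℝ) ^ η) ^ a :=
        (one_add_mul_le_pow (by have : 0 < η * Real.log 2 := by positivity
                                linarith) a).trans
          (pow_le_pow_left₀ (by positivity) (h3.trans h2) a)
      have h5 : K * (1 + (a : ℝ) * (η * Real.log 2)) =
          1 + a + (a * (η * Real.log 2) + 1 / (η * Real.log 2)) := by
        rw [hK]; field_simp; ring
      have h6 : 0 ≤ (a : ℝ) * (η * Real.log 2) + 1 / (η * Real.log 2) := by positivity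
      have h7 := mul_le_mul_of_nonneg_left h4 (zero_le_one.trans hK1)
      push_cast
      linarith
    · have h2 := pow_le_pow_left₀ (by norm_num) (hM p (not_lt.1 h)) a
      have h3 : ((a + 1 : ℕ) : ℝ) ≤ 2 ^ a := by exact_mod_cast Nat.lt_two_pow_self
      linarith
  refine ⟨K ^ M, by positivity, fun n hn => ?_⟩
  rw [Nat.card_divisors hn]
  push_cast
  calc ∏ p ∈ n.primeFactors, ((n.factorization p : ℝ) + 1)
      ≤ ∏ p ∈ n.primeFactors,
          ((if p < M then K else 1) * ((p ^ n.factorization p : ℕ) : ℝ) ^ η) := by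
        refine Finset.prod_le_prod (fun p _ => by positivity) fun p hp => ?_
        have := key p (n.factorization p) (Nat.prime_of_mem_primeFactors hp)
        push_cast at this ⊢
        exact this
    _ = (∏ p ∈ n.primeFactors, (if p < M then K else 1)) * (n : ℝ) ^ η := by
        rw [Finset.prod_mul_distrib, Real.finsetProd_rpow _ _ (fun _ _ => by positivity)]
        congr 2
        conv_rhs => rw [← Nat.prod_factorization_pow_eq_self hn]
        rw [Finsupp.prod, Nat.support_factorization]
        push_cast
        rfl
    _ ≤ K ^ M * (n : ℝ) ^ η := by
        gcongr
        rw [Finset.prod_ite, Finset.prod_const, Finset.prod_const_one, mul_one]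
        refine pow_le_pow_right₀ hK1 ?_
        calc _ ≤ (Finset.range M).card := Finset.card_le_card fun p hp => by
              simpa using (Finset.mem_filter.1 hp).2
          _ = M := Finset.card_range M

/-- A weak form of Chebyshev's lower bound for the number of primes up to `n`. -/
lemma eventually_rpow_add_one_le_primeCounting {η : ℝ} (hη : 0 < η) (hη1 : η ≤ 1) :
    ∀ᶠ n : ℕ in Filter.atTop, (n : ℝ) ^ (1 - η) + 1 ≤ (Nat.primeCounting n : ℝ) := by
  have h1 := tendsto_natCast_atTop_atTop.eventually
    ((isLittleO_log_rpow_atTop hη).bound (show (0 : ℝ) < 1 / 4 by norm_num))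
  have h2 := (Filter.tendsto_atTop_add_const_right _ (1 : ℝ)
    (tendsto_natCast_atTop_atTop (R := ℝ))).eventually
    (Real.isLittleO_log_id_atTop.bound (show (0 : ℝ) < 1 / 20 by norm_num))
  filter_upwards [h1, h2, Filter.eventually_ge_atTop 2] with n h1 h2 hn
  have hn' : (2 : ℝ) ≤ n := by exact_mod_cast hn
  have hlog : 0 < Real.log n := Real.log_pos (by linarith)
  rw [Real.norm_of_nonneg hlog.le, Real.norm_of_nonneg (by positivity)] at h1
  rw [Real.norm_of_nonneg (Real.log_nonneg (by linarith)), id,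
    Real.norm_of_nonneg (by positivity)] at h2
  refine le_trans ?_ (Chebyshev.pi_ge n)
  rw [le_div_iff₀ hlog]
  have h3 : (1 : ℝ) ≤ (n : ℝ) ^ (1 - η) := Real.one_le_rpow (by linarith) (by linarith)
  have h4 : (n : ℝ) ^ (1 - η) * (n : ℝ) ^ η = n := by
    rw [← Real.rpow_add (by linarith)]; simp
  have h5 : (n : ℝ) ^ (1 - η) * Real.log n ≤ n / 4 := by
    calc _ ≤ (n : ℝ) ^ (1 - η) * (1 / 4 * (n : ℝ) ^ η) := by gcongr
      _ = n / 4 := by rw [← mul_assoc, mul_comm _ (1 / 4 : ℝ), mul_assoc, h4]; ring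
  have h6 : Real.log n ≤ (n : ℝ) ^ (1 - η) * Real.log n := le_mul_of_one_le_left hlog.le h3
  have h7 := Real.log_two_gt_d9
  nlinarith

/-- The number of solutions of `n - p ^ 2 = n' - q ^ 2` is at most the number of divisors of
`|n - n'|` when `n ≠ n'`. -/
lemma card_filter_add_sq_le_card_divisors (P : Finset ℕ) {n n' : ℕ} (h : n ≠ n') :
    ((P ×ˢ P).filter fun x : ℕ × ℕ => n + x.2 ^ 2 = n' + x.1 ^ 2).card ≤
      ((n : ℤ) - n').natAbs.divisors.card := by
  have hne : ((n : ℤ) - n') ≠ 0 := sub_ne_zero.2 (by exact_mod_cast h)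
  have hfac : ∀ x ∈ (P ×ˢ P).filter (fun x : ℕ × ℕ => n + x.2 ^ 2 = n' + x.1 ^ 2),
      (n : ℤ) - n' = ((x.1 + x.2 : ℕ) : ℤ) * ((x.1 : ℤ) - x.2) := by
    intro x hx
    have : (n : ℤ) + x.2 ^ 2 = n' + x.1 ^ 2 := by exact_mod_cast (Finset.mem_filter.1 hx).2
    push_cast
    linarith
  refine Finset.card_le_card_of_injOn (fun x => x.1 + x.2) (fun x hx => ?_)
    fun x hx y hy hxy => ?_
  · simp only [Finset.mem_coe, Nat.mem_divisors]
    exact ⟨Int.natCast_dvd.1 ⟨_, hfac x hx⟩, Int.natAbs_ne_zero.2 hne⟩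
  · have h1 := hfac x hx
    have h2 := hfac y hy
    simp only at hxy
    rw [← hxy] at h2
    have h3 : ((x.1 + x.2 : ℕ) : ℤ) ≠ 0 := fun h0 => hne (by rw [h1, h0, zero_mul])
    have h4 := mul_left_cancel₀ h3 (h1.symm.trans h2)
    ext <;> omega

/-- The transference inequality: if `n - p ^ 2 ∈ M` for all `n ∈ E` and `p ∈ P`, then `E` is
controlled by `M`, `P` and the numbers of divisors of the differences of elements of `E`. -/
lemma sq_card_mul_card_le (E P M : Finset ℕ) {D : ℝ} (hD0 : 0 ≤ D)
    (hmap : ∀ n ∈ E, ∀ p ∈ P, p ^ 2 ≤ n ∧ n - p ^ 2 ∈ M)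
    (hD : ∀ n ∈ E, ∀ n' ∈ E, n ≠ n' → (((n : ℤ) - n').natAbs.divisors.card : ℝ) ≤ D) :
    ((E.card : ℝ) * P.card) ^ 2 ≤ M.card * (E.card * P.card + (E.card : ℝ) ^ 2 * D) := by
  set r : ℕ → ℕ → ℕ := fun n m => (P.filter fun p => n - p ^ 2 = m).card with hr
  have hsum : ∀ n ∈ E, ∑ m ∈ M, r n m = P.card := fun n hn =>
    (Finset.card_eq_sum_card_fiberwise fun p hp => (hmap n hn p hp).2).symm
  have hpair : ∀ n ∈ E, ∀ n' ∈ E, ∑ m ∈ M, r n m * r n' m =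
      ((P ×ˢ P).filter fun x : ℕ × ℕ => n + x.2 ^ 2 = n' + x.1 ^ 2).card := by
    intro n hn n' hn'
    rw [Finset.card_eq_sum_card_fiberwise (f := fun x : ℕ × ℕ => n - x.1 ^ 2) (t := M)
      (fun x hx => (hmap n hn x.1 (Finset.mem_product.1 (Finset.mem_filter.1 hx).1).1).2)]
    refine Finset.sum_congr rfl fun m _ => ?_
    rw [hr, ← Finset.card_product]
    congr 1
    ext x
    simp only [Finset.mem_product, Finset.mem_filter]
    constructor
    · rintro ⟨⟨h1, h2⟩, h3, h4⟩
      have := (hmap n hn _ h1).1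
      have := (hmap n' hn' _ h3).1
      exact ⟨⟨⟨h1, h3⟩, by omega⟩, h2⟩
    · rintro ⟨⟨⟨h1, h3⟩, h4⟩, h2⟩
      have := (hmap n hn _ h1).1
      have := (hmap n' hn' _ h3).1
      exact ⟨⟨h1, h2⟩, h3, by omega⟩
  have hdiag : ∀ n : ℕ,
      ((P ×ˢ P).filter fun x : ℕ × ℕ => n + x.2 ^ 2 = n + x.1 ^ 2).card ≤ P.card := by
    intro n
    refine Finset.card_le_card_of_injOn Prod.fst
      (fun x hx => (Finset.mem_product.1 (Finset.mem_filter.1 hx).1).1) fun x hx y hy hxy => ?_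
    have h1 : x.2 = x.1 := Nat.pow_left_injective two_ne_zero
      (Nat.add_left_cancel (Finset.mem_filter.1 hx).2)
    have h2 : y.2 = y.1 := Nat.pow_left_injective two_ne_zero
      (Nat.add_left_cancel (Finset.mem_filter.1 hy).2)
    ext
    · exact hxy
    · rw [h1, h2, hxy]
  have hbound : ∀ n ∈ E, ∀ n' ∈ E, ((∑ m ∈ M, r n m * r n' m : ℕ) : ℝ) ≤
      (if n = n' then (P.card : ℝ) else D) := by
    intro n hn n' hn'
    rw [hpair n hn n' hn']
    split_ifs with h
    · subst h
      exact_mod_cast hdiag n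
    · exact le_trans (by exact_mod_cast card_filter_add_sq_le_card_divisors P h)
        (hD n hn n' hn' h)
  have h1 : (E.card : ℝ) * P.card = ∑ m ∈ M, ((∑ n ∈ E, r n m : ℕ) : ℝ) := by
    have : ∑ m ∈ M, ∑ n ∈ E, r n m = E.card * P.card := by
      rw [Finset.sum_comm, Finset.sum_congr rfl hsum, Finset.sum_const, smul_eq_mul]
    exact_mod_cast this.symm
  rw [h1]
  refine sq_sum_le_card_mul_sum_sq.trans ?_
  rw [← h1]
  gcongr
  calc ∑ m ∈ M, ((∑ n ∈ E, r n m : ℕ) : ℝ) ^ 2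
      = ∑ n ∈ E, ∑ n' ∈ E, ((∑ m ∈ M, r n m * r n' m : ℕ) : ℝ) := by
        push_cast
        simp_rw [sq, Finset.sum_mul_sum]
        rw [Finset.sum_comm]
        exact Finset.sum_congr rfl fun n _ => Finset.sum_comm
    _ ≤ ∑ n ∈ E, ∑ n' ∈ E, ((if n = n' then (P.card : ℝ) else 0) + D) := by
        refine Finset.sum_le_sum fun n hn => Finset.sum_le_sum fun n' hn' =>
          (hbound n hn n' hn').trans ?_
        split_ifs <;> linarith
    _ = E.card * P.card + (E.card : ℝ) ^ 2 * D := by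
        simp only [Finset.sum_add_distrib, Finset.sum_const, nsmul_eq_mul]
        rw [Finset.sum_congr rfl fun n hn => by rw [Finset.sum_ite_eq, if_pos hn],
          Finset.sum_const, nsmul_eq_mul]
        ring

/-- A power bound on dyadic blocks gives the same power bound on initial segments. -/
lemma exists_card_filter_Icc_le_of_dyadic (q : ℕ → Prop) {a C' : ℝ} (ha : 0 < a) {N₁ : ℕ}
    (h : ∀ N : ℕ, N₁ ≤ N →
      (((Finset.Ioc (N / 2) N).filter q).card : ℝ) ≤ C' * (N : ℝ) ^ a) :
    ∃ C : ℝ, 0 < C ∧ ∀ N : ℕ,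
      (((Finset.Icc 1 N).filter q).card : ℝ) ≤ C * (N : ℝ) ^ a := by
  have h2 : 1 < (2 : ℝ) ^ a := Real.one_lt_rpow one_lt_two ha
  set θ : ℝ := 1 / (2 : ℝ) ^ a with hθ
  have hθ1 : θ < 1 := by rw [hθ, div_lt_one (by positivity)]; exact h2
  set C : ℝ := max (N₁ + 1 : ℝ) (C' / (1 - θ)) with hC
  have hCN : (N₁ + 1 : ℝ) ≤ C := le_max_left _ _
  have hC0 : 0 < C := lt_of_lt_of_le (by positivity) hCN
  have hCC : C' ≤ C * (1 - θ) := (div_le_iff₀ (by linarith)).1 (le_max_right _ _)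
  refine ⟨C, hC0, fun N => ?_⟩
  induction N using Nat.strong_induction_on with
  | _ N ih =>
    rcases Nat.eq_zero_or_pos N with rfl | hN
    · simp; positivity
    have hN' : (1 : ℝ) ≤ N := by exact_mod_cast hN
    rcases lt_or_ge N N₁ with hlt | hge
    · have h3 : (1 : ℝ) ≤ (N : ℝ) ^ a := Real.one_le_rpow hN' ha.le
      have h4 : (((Finset.Icc 1 N).filter q).card : ℝ) ≤ N := by
        exact_mod_cast (Finset.card_filter_le _ _).trans (by simp)
      have h5 : (N : ℝ) ≤ N₁ := by exact_mod_cast hlt.le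
      nlinarith
    · have hsub : (Finset.Icc 1 N).filter q ⊆
          (Finset.Icc 1 (N / 2)).filter q ∪ (Finset.Ioc (N / 2) N).filter q := by
        intro n hn
        simp only [Finset.mem_union, Finset.mem_filter, Finset.mem_Icc, Finset.mem_Ioc] at hn ⊢
        rcases le_or_gt n (N / 2) with h6 | h6
        · exact Or.inl ⟨⟨hn.1.1, h6⟩, hn.2⟩
        · exact Or.inr ⟨⟨h6, hn.1.2⟩, hn.2⟩
      have h3 : (((Finset.Icc 1 N).filter q).card : ℝ) ≤
          ((Finset.Icc 1 (N / 2)).filter q).card + ((Finset.Ioc (N / 2) N).filter q).card := by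
        exact_mod_cast (Finset.card_le_card hsub).trans (Finset.card_union_le _ _)
      have h4 : ((N / 2 : ℕ) : ℝ) ^ a ≤ θ * (N : ℝ) ^ a := by
        calc ((N / 2 : ℕ) : ℝ) ^ a ≤ ((N : ℝ) / 2) ^ a :=
              Real.rpow_le_rpow (by positivity) Nat.cast_div_le ha.le
          _ = θ * (N : ℝ) ^ a := by
              rw [Real.div_rpow (by positivity) (by positivity), hθ]; ring
      have h5 := ih (N / 2) (by omega)
      have h6 := h N hge
      have h7 : 0 ≤ (N : ℝ) ^ a := by positivity
      have h8 := mul_le_mul_of_nonneg_left h4 hC0.le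
      have h9 := mul_le_mul_of_nonneg_right hCC h7
      linarith

/-- If subtracting any not too large odd prime square from an element of `E₂` leads to `E₁`, then
a density bound for `E₁` gives, on dyadic blocks, a bound for `E₂` saving a further `N ^ (1/2)`. -/
lemma exists_card_dyadic_le_of_sub_prime_sq_mem {E₁ : Set ℕ} {q : ℕ → Prop} {δ ε : ℝ}
    (hε : 0 < ε) (hεδ : ε < δ) (hδ : δ ≤ 1)
    (hsub : ∃ N₀ : ℕ, ∀ n, q n → ∀ p : ℕ, p.Prime → p ≠ 2 → p ^ 2 + N₀ ≤ n → n - p ^ 2 ∈ E₁)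
    (hE₁ : ∀ ε : ℝ, 0 < ε → ∃ C : ℝ, 0 < C ∧ ∀ N : ℕ,
      (((Finset.Icc 1 N).filter (fun n => n ∈ E₁)).card : ℝ) ≤ C * (N : ℝ) ^ (1 - δ + ε)) :
    ∃ (C : ℝ) (N₁ : ℕ), ∀ N : ℕ, N₁ ≤ N →
      (((Finset.Ioc (N / 2) N).filter q).card : ℝ) ≤ C * (N : ℝ) ^ (1 / 2 - δ + ε) := by
  obtain ⟨N₀, hN₀⟩ := hsub
  set η : ℝ := ε / 4 with hη
  have hη0 : 0 < η := by positivity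
  obtain ⟨C₁, hC₁, hM⟩ := hE₁ η hη0
  obtain ⟨C₂, hC₂, hdiv⟩ := exists_card_divisors_le_mul_rpow hη0
  refine ⟨8 * C₁, ?_⟩
  have hfloor : Filter.Tendsto (fun N : ℕ => ⌊√(N : ℝ) / 2⌋₊) Filter.atTop Filter.atTop :=
    tendsto_nat_floor_atTop.comp
      ((Real.tendsto_sqrt_atTop.comp tendsto_natCast_atTop_atTop).atTop_div_const two_pos)
  have hpi := hfloor.eventually
    (eventually_rpow_add_one_le_primeCounting hη0 (by linarith))
  have hbig := ((tendsto_rpow_atTop (sub_pos.2 hεδ)).comp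
    tendsto_natCast_atTop_atTop).eventually_ge_atTop (32 * C₁ * C₂)
  refine Filter.eventually_atTop.1 ?_
  filter_upwards [hpi, hbig, Filter.eventually_ge_atTop 16,
    Filter.eventually_ge_atTop (4 * (N₀ + 1))] with N hpi hbig hN16 hNN₀
  simp only [Function.comp_apply] at hbig
  set K : ℕ := ⌊√(N : ℝ) / 2⌋₊ with hK
  have hN16' : (16 : ℝ) ≤ N := by exact_mod_cast hN16
  have hNpos : (0 : ℝ) < N := by linarith
  have hN1 : (1 : ℝ) ≤ N := by linarith
  have hKle : ∀ p ≤ K, 4 * p ^ 2 ≤ N := by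
    intro p hp
    have h1 : (p : ℝ) ≤ √(N : ℝ) / 2 := (Nat.le_floor_iff (by positivity)).1 hp
    have h2 : (2 * (p : ℝ)) ^ 2 ≤ N := by
      rw [← Real.sq_sqrt hNpos.le]
      exact pow_le_pow_left₀ (by positivity) (by linarith) 2
    have h3 : 4 * (p : ℝ) ^ 2 ≤ N := by linarith
    exact_mod_cast h3
  set E := (Finset.Ioc (N / 2) N).filter q with hE
  set P := (Nat.primesLE K).erase 2 with hP
  set M := (Finset.Icc 1 N).filter (fun n => n ∈ E₁) with hMdef
  have hmap : ∀ n ∈ E, ∀ p ∈ P, p ^ 2 ≤ n ∧ n - p ^ 2 ∈ M := by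
    intro n hn p hp
    obtain ⟨hn1, hn2⟩ := Finset.mem_filter.1 hn
    obtain ⟨hp2, hp1⟩ := Finset.mem_erase.1 hp
    obtain ⟨hp3, hp4⟩ := Nat.mem_primesLE.1 hp1
    have h1 := hKle p hp3
    have h2 := Finset.mem_Ioc.1 hn1
    have h3 := hN₀ n hn2 p hp4 hp2 (by omega)
    refine ⟨by omega, Finset.mem_filter.2 ⟨Finset.mem_Icc.2 (by omega), h3⟩⟩
  have hD : ∀ n ∈ E, ∀ n' ∈ E, n ≠ n' →
      (((n : ℤ) - n').natAbs.divisors.card : ℝ) ≤ C₂ * (N : ℝ) ^ η := by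
    intro n hn n' hn' hne
    have h1 := Finset.mem_Ioc.1 (Finset.mem_filter.1 hn).1
    have h2 := Finset.mem_Ioc.1 (Finset.mem_filter.1 hn').1
    have h3 : ((n : ℤ) - n').natAbs ≤ N := by omega
    refine (hdiv _ (by omega)).trans ?_
    gcongr
  have hmain := sq_card_mul_card_le E P M (by positivity) hmap hD
  have hPcard : (N : ℝ) ^ (1 / 2 - η) / 4 ≤ P.card := by
    have h1 : (Nat.primeCounting K : ℝ) ≤ P.card + 1 := by
      rw [← Nat.primesLE_card_eq_primeCounting]
      exact_mod_cast Nat.le_add_of_sub_le Finset.pred_card_le_card_erase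
    have hs4 : (4 : ℝ) ≤ √(N : ℝ) := Real.le_sqrt_of_sq_le (by linarith)
    have h2 : √(N : ℝ) / 4 ≤ K := by
      have := Nat.lt_floor_add_one (√(N : ℝ) / 2)
      rw [← hK] at this
      linarith
    have h3 : (√(N : ℝ) / 4) ^ (1 - η) ≤ (K : ℝ) ^ (1 - η) :=
      Real.rpow_le_rpow (by positivity) h2 (by linarith)
    have h4 : (N : ℝ) ^ (1 / 2 - η) / 4 ≤ (√(N : ℝ) / 4) ^ (1 - η) := by
      rw [Real.div_rpow (by positivity) (by norm_num), Real.sqrt_eq_rpow,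
        ← Real.rpow_mul hNpos.le]
      apply div_le_div₀ (by positivity) _ (by positivity) _
      · exact Real.rpow_le_rpow_of_exponent_le hN1 (by linarith)
      · calc (4 : ℝ) ^ (1 - η) ≤ 4 ^ (1 : ℝ) :=
              Real.rpow_le_rpow_of_exponent_le (by norm_num) (by linarith)
          _ = 4 := Real.rpow_one 4
    linarith
  set x : ℝ := (E.card : ℝ)
  set y : ℝ := (P.card : ℝ)
  set z : ℝ := (M.card : ℝ)
  have hx : 0 ≤ x := Nat.cast_nonneg _
  have hu : 0 < (N : ℝ) ^ (1 / 2 - η) / 4 := by positivity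
  have hy : 0 < y := hu.trans_le hPcard
  have hz : z ≤ C₁ * (N : ℝ) ^ (1 - δ + η) := hM N
  have hzD : z * (C₂ * (N : ℝ) ^ η) ≤ y ^ 2 / 2 := by
    calc z * (C₂ * (N : ℝ) ^ η)
        ≤ C₁ * (N : ℝ) ^ (1 - δ + η) * (C₂ * (N : ℝ) ^ η) := by gcongr
      _ = (32 * C₁ * C₂) * (N : ℝ) ^ (1 - δ + η + η) / 32 := by
          rw [Real.rpow_add hNpos (1 - δ + η)]; ring
      _ ≤ (N : ℝ) ^ (δ - ε) * (N : ℝ) ^ (1 - δ + η + η) / 32 := by gcongr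
      _ = ((N : ℝ) ^ (1 / 2 - η) / 4) ^ 2 / 2 := by
          rw [div_pow, sq ((N : ℝ) ^ _), ← Real.rpow_add hNpos, ← Real.rpow_add hNpos]
          have : δ - ε + (1 - δ + η + η) = 1 / 2 - η + (1 / 2 - η) := by rw [hη]; ring
          rw [this]; ring
      _ ≤ y ^ 2 / 2 := by gcongr
  have hxy : x * y ≤ 2 * z := by
    rcases hx.eq_or_lt with h0 | h0
    · rw [← h0, zero_mul]; positivity
    · have h1 := mul_le_mul_of_nonneg_left hzD (sq_nonneg x)
      refine le_of_mul_le_mul_left ?_ (mul_pos h0 hy)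
      nlinarith
  refine le_of_mul_le_mul_right ?_ hu
  calc x * ((N : ℝ) ^ (1 / 2 - η) / 4) ≤ x * y := by gcongr
    _ ≤ 2 * (C₁ * (N : ℝ) ^ (1 - δ + η)) := by linarith
    _ ≤ 2 * (C₁ * (N : ℝ) ^ ((1 / 2 - δ + ε) + (1 / 2 - η))) := by
        have := Real.rpow_le_rpow_of_exponent_le hN1
          (show 1 - δ + η ≤ (1 / 2 - δ + ε) + (1 / 2 - η) by linarith)
        gcongr 2 * (C₁ * ?_)
    _ = 8 * C₁ * (N : ℝ) ^ (1 / 2 - δ + ε) * ((N : ℝ) ^ (1 / 2 - η) / 4) := by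
        rw [Real.rpow_add hNpos]; ring

/-- First step of the proof: adding a prime square to sums of fifteen fifth powers of primes. -/
theorem step_add_prime_square (E₁ : Set ℕ)
    (hrep : ∃ N₀ : ℕ, ∀ n : ℕ, N₀ ≤ n → n % 2 = 1 → n ∉ E₁ → Rep15 n)
    (hE₁ : ∀ ε : ℝ, 0 < ε → ∃ C : ℝ, 0 < C ∧ ∀ N : ℕ,
      (((Finset.Icc 1 N).filter (fun n => n ∈ E₁)).card : ℝ) ≤
        C * (N : ℝ) ^ (1 - (1 : ℝ) / 10 - 27 / 3200 + ε)) :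
    ∀ ε : ℝ, 0 < ε → ∃ C : ℝ, 0 < C ∧ ∀ N : ℕ,
      (((Finset.Icc 1 N).filter (fun n => n % 2 = 0 ∧ ¬RepSq15 n)).card : ℝ) ≤
        C * (N : ℝ) ^ ((1 : ℝ) / 2 - (1 : ℝ) / 10 - 27 / 3200 + ε) := by
  intro ε hε
  have hε' : 0 < min ε (1 / 10) := lt_min hε (by norm_num)
  have hle : min ε (1 / 10) ≤ 1 / 10 := min_le_right _ _
  have hsub : ∃ N₀ : ℕ, ∀ n, (n % 2 = 0 ∧ ¬RepSq15 n) → ∀ p : ℕ, p.Prime → p ≠ 2 →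
      p ^ 2 + N₀ ≤ n → n - p ^ 2 ∈ E₁ := by
    obtain ⟨N₀, hN₀⟩ := hrep
    refine ⟨N₀, fun n ⟨hn, hnr⟩ p hp hp2 hpn => ?_⟩
    by_contra hmem
    have hodd : p ^ 2 % 2 = 1 := Nat.odd_iff.1 ((hp.odd_of_ne_two hp2).pow)
    obtain ⟨f, hf, hsum⟩ := hN₀ (n - p ^ 2) (by omega) (by omega) hmem
    exact hnr ⟨p, f, hp, hf, by omega⟩
  obtain ⟨C', N₁, hC'⟩ := exists_card_dyadic_le_of_sub_prime_sq_mem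
    (δ := 1 / 10 + 27 / 3200) hε' (by linarith) (by norm_num) hsub
    (by simpa only [sub_sub] using hE₁)
  obtain ⟨C, hC, hCN⟩ := exists_card_filter_Icc_le_of_dyadic _ (by linarith) hC'
  refine ⟨C, hC, fun N => ?_⟩
  rcases Nat.eq_zero_or_pos N with rfl | hN
  · simp only [Finset.Icc_eq_empty_of_lt zero_lt_one, Finset.filter_empty, Finset.card_empty,
      Nat.cast_zero]
    positivity
  · refine le_trans (le_of_eq ?_) ((hCN N).trans ?_)
    · congr
    · refine mul_le_mul_of_nonneg_left
        (Real.rpow_le_rpow_of_exponent_le (by exact_mod_cast hN) ?_) hC.le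
      linarith [min_le_left ε (1 / 10)]
end

section
/- Assume the set E₂ of even n not representable as p² + p₁⁵ + ⋯ + p₁₅⁵ (primes) satisfies |E₂ ∩ [1,N]| ≪ N^{1/2 − 1/10 − 27/3200 + ε}. Then the set E₃ of odd n not representable as p² + p₁⁵ + ⋯ + p₁₆⁵ (primes) satisfies |E₃ ∩ [1,N]| ≪ N^{1/5 − 27/3200 + ε} for every ε > 0. -/
open scoped Classical

/-- `n` is a sum of one square of a prime and sixteen fifth powers of primes. -/
def RepSq16 (n : ℕ) : Prop :=
  ∃ (p : ℕ) (f : Fin 16 → ℕ), p.Prime ∧ (∀ i, (f i).Prime) ∧ n = p ^ 2 + ∑ i, (f i) ^ 5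

theorem card_sq_le_card_mul_card_collisions {α β : Type*} {s : Finset α} {t : Finset β}
    {f : α → β} (hf : ∀ x ∈ s, f x ∈ t) :
    s.card ^ 2 ≤ t.card * ((s ×ˢ s).filter (fun x => f x.1 = f x.2)).card := by
  have hsum : ((s ×ˢ s).filter (fun x => f x.1 = f x.2)).card =
      ∑ b ∈ t, (s.filter (fun x => f x = b)).card ^ 2 := by
    rw [Finset.card_eq_sum_card_fiberwise (f := fun x => f x.1) (t := t)]
    · refine Finset.sum_congr rfl fun b _ => ?_
      rw [sq, ← Finset.card_product]
      congr 1
      ext ⟨x, y⟩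
      simp only [Finset.mem_filter, Finset.mem_product]
      grind
    · intro x hx
      simp only [Finset.coe_filter, Finset.mem_product, Set.mem_ofPred_eq] at hx
      exact hf _ hx.1.1
  rw [hsum, Finset.card_eq_sum_card_fiberwise hf]
  exact sq_sum_le_card_mul_sum_sq

theorem pow_succ_add_sub_pow_succ (k d y : ℕ) : (y + d) ^ (k + 1) - y ^ (k + 1) =
    y * ((y + d) ^ k - y ^ k) + d * (y + d) ^ k := by
  obtain ⟨u, hu⟩ := Nat.exists_eq_add_of_le (Nat.pow_le_pow_left (Nat.le_add_right y d) k)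
  rw [Nat.sub_eq_iff_eq_add (Nat.pow_le_pow_left (Nat.le_add_right y d) _), pow_succ, hu,
    Nat.add_sub_cancel_left]
  ring

theorem pow_add_sub_pow_monotone (k d : ℕ) : Monotone fun y : ℕ => (y + d) ^ k - y ^ k := by
  induction k with
  | zero => intro a b _; simp
  | succ k ih =>
    intro a b hab
    have := ih hab
    simp only [pow_succ_add_sub_pow_succ] at this ⊢
    gcongr

theorem pow_add_sub_pow_strictMono {k d : ℕ} (hk : 2 ≤ k) (hd : 0 < d) :
    StrictMono fun y : ℕ => (y + d) ^ k - y ^ k := by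
  obtain ⟨k, rfl⟩ : ∃ j, k = j + 1 := ⟨k - 1, by omega⟩
  intro a b hab
  have h1 := pow_add_sub_pow_monotone k d hab.le
  have h2 : (a + d) ^ k < (b + d) ^ k := Nat.pow_lt_pow_left (by omega) (by omega)
  simp only [pow_succ_add_sub_pow_succ] at h1 ⊢
  exact add_lt_add_of_le_of_lt (Nat.mul_le_mul hab.le h1) (Nat.mul_lt_mul_of_pos_left h2 hd)

theorem card_pow_eq_add_pow_le_card_divisors {k h : ℕ} (hk : 2 ≤ k) (hh : 0 < h) (A : Finset ℕ) :
    ((A ×ˢ A).filter (fun x => x.1 ^ k = h + x.2 ^ k)).card ≤ h.divisors.card := by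
  have hlt : ∀ x y : ℕ, x ^ k = h + y ^ k → y < x := fun x y hxy =>
    lt_of_pow_lt_pow_left₀ k (Nat.zero_le _) (by omega)
  refine Finset.card_le_card_of_injOn (fun x => x.1 - x.2) ?_ ?_
  · rintro ⟨x, y⟩ hx
    simp only [Finset.coe_filter, Finset.mem_product, Set.mem_ofPred_eq] at hx
    simp only [Finset.mem_coe, Nat.mem_divisors]
    refine ⟨?_, hh.ne'⟩
    have := Nat.sub_dvd_pow_sub_pow x y k
    rwa [hx.2, Nat.add_sub_cancel] at this
  · rintro ⟨x, y⟩ hx ⟨x', y'⟩ hx' hd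
    simp only [Finset.coe_filter, Finset.mem_product, Set.mem_ofPred_eq] at hx hx' hd
    have h1 := hlt _ _ hx.2
    have h2 := hlt _ _ hx'.2
    obtain ⟨d, rfl⟩ := Nat.exists_eq_add_of_le h1.le
    obtain rfl : x' = y' + d := by omega
    have : y = y' := by
      apply (pow_add_sub_pow_strictMono hk (show 0 < d by omega)).injective
      have := hx.2
      have := hx'.2
      simp only
      omega
    simp [this]

/-- The Kawada–Wooley transference inequality for `k`-th powers. -/
theorem card_sq_mul_card_sq_le {k T : ℕ} (hk : 2 ≤ k) {Z A E : Finset ℕ}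
    (hle : ∀ n ∈ Z, ∀ p ∈ A, p ^ k ≤ n) (hE : ∀ n ∈ Z, ∀ p ∈ A, n - p ^ k ∈ E)
    (hT : ∀ n ∈ Z, ∀ h, 0 < h → h ≤ n → h.divisors.card ≤ T) :
    (Z.card * A.card) ^ 2 ≤ E.card * (Z.card * A.card + T * Z.card ^ 2) := by
  have hcs := card_sq_le_card_mul_card_collisions (s := Z ×ˢ A) (t := E)
    (f := fun x => x.1 - x.2 ^ k) (by
      rintro ⟨n, p⟩ hx
      rw [Finset.mem_product] at hx
      exact hE n hx.1 p hx.2)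
  rw [Finset.card_product] at hcs
  refine hcs.trans (Nat.mul_le_mul_left _ ?_)
  have hfib : ∀ b ∈ Z ×ˢ Z, ((((Z ×ˢ A) ×ˢ (Z ×ˢ A)).filter
      (fun x => x.1.1 - x.1.2 ^ k = x.2.1 - x.2.2 ^ k)).filter
        (fun x => (x.1.1, x.2.1) = b)).card ≤ (if b.1 = b.2 then A.card else 0) + T := by
    rintro ⟨n, m⟩ hb
    rw [Finset.mem_product] at hb
    have hinj : Set.InjOn (fun x : (ℕ × ℕ) × ℕ × ℕ => (x.1.2, x.2.2))
        {x | (x.1.1, x.2.1) = (n, m)} := by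
      rintro ⟨⟨a, b⟩, c, d⟩ h ⟨⟨a', b'⟩, c', d'⟩ h' e
      simp only [Set.mem_ofPred_eq, Prod.mk.injEq] at h h' e ⊢
      grind
    have hcard : ∀ S : Finset (ℕ × ℕ), (∀ p ∈ A, ∀ q ∈ A, n + q ^ k = m + p ^ k → (p, q) ∈ S) →
        ((((Z ×ˢ A) ×ˢ (Z ×ˢ A)).filter
          (fun x => x.1.1 - x.1.2 ^ k = x.2.1 - x.2.2 ^ k)).filter
            (fun x => (x.1.1, x.2.1) = (n, m))).card ≤ S.card := by
      intro S hS
      refine Finset.card_le_card_of_injOn (fun x => (x.1.2, x.2.2)) ?_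
        (hinj.mono fun x hx => (Finset.mem_filter.1 hx).2)
      rintro ⟨⟨a, p⟩, c, q⟩ hx
      simp only [Finset.coe_filter, Finset.mem_filter, Finset.mem_product, Set.mem_ofPred_eq,
        Prod.mk.injEq] at hx
      obtain ⟨⟨⟨⟨ha, hp⟩, hc, hq⟩, heq⟩, rfl, rfl⟩ := hx
      have h1 := hle _ ha _ hp
      have h2 := hle _ hc _ hq
      exact hS p hp q hq (by omega)
    rcases lt_trichotomy n m with hnm | hnm | hnm
    · refine (hcard (((A ×ˢ A).filter (fun x => x.1 ^ k = (m - n) + x.2 ^ k)).map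
        (Equiv.prodComm ℕ ℕ).toEmbedding) ?_).trans ?_
      · intro p hp q hq h
        simp only [Finset.mem_map_equiv, Finset.mem_filter, Finset.mem_product,
          Equiv.prodComm_symm, Equiv.prodComm_apply, Prod.swap_prod_mk]
        exact ⟨⟨hq, hp⟩, by omega⟩
      · rw [Finset.card_map]
        exact (card_pow_eq_add_pow_le_card_divisors hk (by omega) A).trans
          ((hT m hb.2 _ (by omega) (by omega)).trans (Nat.le_add_left _ _))
    · subst hnm
      refine (hcard (A.diag) ?_).trans ?_
      · intro p hp q hq h
        rw [Finset.mem_diag]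
        exact ⟨hp, (Nat.pow_left_injective (by omega : k ≠ 0) (by simp only; omega))⟩
      · simp
    · refine (hcard ((A ×ˢ A).filter (fun x => x.1 ^ k = (n - m) + x.2 ^ k)) ?_).trans ?_
      · intro p hp q hq h
        simp only [Finset.mem_filter, Finset.mem_product]
        exact ⟨⟨hp, hq⟩, by omega⟩
      · exact (card_pow_eq_add_pow_le_card_divisors hk (by omega) A).trans
          ((hT n hb.1 _ (by omega) (by omega)).trans (Nat.le_add_left _ _))
  rw [Finset.card_eq_sum_card_fiberwise (f := fun x => (x.1.1, x.2.1)) (t := Z ×ˢ Z)]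
  · refine le_trans (Finset.sum_le_sum fun b hb => le_of_eq_of_le (by congr!) (hfib b hb)) ?_
    rw [Finset.sum_add_distrib, Finset.sum_product]
    simp only [Finset.sum_ite_eq, Finset.sum_const, smul_eq_mul, Finset.card_product]
    rw [Finset.sum_congr rfl (fun x hx => if_pos hx)]
    simp only [Finset.sum_const, smul_eq_mul]
    exact le_of_eq (by ring)
  · rintro ⟨⟨a, p⟩, c, q⟩ hx
    simp only [Finset.coe_filter, Finset.mem_product, Set.mem_ofPred_eq] at hx
    simpa using ⟨hx.1.1.1, hx.1.2.1⟩

theorem card_divisors_le_mul_rpow {ε : ℝ} (hε : 0 < ε) :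
    ∃ C : ℝ, 0 < C ∧ ∀ n : ℕ, n ≠ 0 → (n.divisors.card : ℝ) ≤ C * (n : ℝ) ^ ε := by
  set K : ℝ := 1 + 1 / (ε * Real.log 2) with hK
  have hl : 0 < ε * Real.log 2 := mul_pos hε (Real.log_pos one_lt_two)
  have hK1 : 1 ≤ K := le_add_of_nonneg_right (by positivity)
  set B : ℕ := ⌈(2 : ℝ) ^ (1 / ε)⌉₊ with hB
  refine ⟨K ^ B, by positivity, fun n hn => ?_⟩
  have hlocal : ∀ p ∈ n.primeFactors, ((n.factorization p + 1 : ℕ) : ℝ) ≤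
      (if p < B then K else 1) * ((p : ℝ) ^ n.factorization p) ^ ε := by
    intro p hp
    set v := n.factorization p
    have hp2 : (2 : ℝ) ≤ p := by exact_mod_cast (Nat.prime_of_mem_primeFactors hp).two_le
    rw [← Real.rpow_natCast, ← Real.rpow_mul (by positivity), mul_comm (v : ℝ) ε,
      Real.rpow_mul (by positivity), Real.rpow_natCast]
    split_ifs with hpB
    · calc ((v + 1 : ℕ) : ℝ) ≤ K * (1 + v * (ε * Real.log 2)) := by
            have : K * (1 + v * (ε * Real.log 2)) =
              1 + v + v * (ε * Real.log 2) + 1 / (ε * Real.log 2) := by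
              rw [hK]; field_simp; ring
            rw [this]; push_cast
            have : 0 ≤ (v : ℝ) * (ε * Real.log 2) + 1 / (ε * Real.log 2) := by positivity
            linarith
        _ ≤ K * ((2 : ℝ) ^ ε) ^ v := by
            gcongr
            rw [Real.rpow_def_of_pos two_pos, ← Real.exp_nat_mul]
            linarith [Real.add_one_le_exp ((v : ℝ) * (Real.log 2 * ε))]
        _ ≤ K * ((p : ℝ) ^ ε) ^ v := by gcongr
    · have h2 : (2 : ℝ) ≤ (p : ℝ) ^ ε := by
        have hBp : (2 : ℝ) ^ (1 / ε) ≤ p :=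
          (Nat.le_ceil _).trans (by exact_mod_cast not_lt.1 hpB)
        calc (2 : ℝ) = ((2 : ℝ) ^ (1 / ε)) ^ ε := by
              rw [← Real.rpow_mul zero_le_two, one_div_mul_cancel hε.ne', Real.rpow_one]
          _ ≤ (p : ℝ) ^ ε := by gcongr
      rw [one_mul]
      calc ((v + 1 : ℕ) : ℝ) ≤ 2 ^ v := by exact_mod_cast Nat.lt_two_pow_self (n := v)
        _ ≤ _ := by gcongr
  rw [Nat.card_divisors hn, Nat.cast_prod]
  refine (Finset.prod_le_prod (fun _ _ => by positivity) hlocal).trans ?_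
  rw [Finset.prod_mul_distrib, Real.finsetProd_rpow _ _ fun _ _ => by positivity]
  have hprod : ∏ p ∈ n.primeFactors, (p : ℝ) ^ n.factorization p = n := by
    conv_rhs => rw [← Nat.prod_factorization_pow_eq_self hn]
    simp [Finsupp.prod]
  rw [hprod]
  gcongr
  rw [← Finset.prod_filter, Finset.prod_const]
  refine pow_le_pow_right₀ hK1 ?_
  calc _ ≤ (Finset.range B).card := Finset.card_le_card fun p hp => by
        simpa using (Finset.mem_filter.1 hp).2
    _ = B := Finset.card_range B

open Filter Asymptotics in
theorem eventually_rpow_le_card_odd_primes {η : ℝ} (hη : 0 < η) :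
    ∀ᶠ X : ℕ in atTop, (X : ℝ) ^ (1 - η) ≤
      ((Finset.Icc 1 X).filter (fun p => p.Prime ∧ p % 2 = 1)).card := by
  have hcount : ∀ X : ℕ, Nat.primeCounting X ≤
      ((Finset.Icc 1 X).filter (fun p => p.Prime ∧ p % 2 = 1)).card + 1 := by
    intro X
    rw [Nat.primeCounting, Nat.primeCounting', Nat.count_eq_card_filter_range]
    refine (Finset.card_le_card (t := insert 2 ((Finset.Icc 1 X).filter
      (fun p => p.Prime ∧ p % 2 = 1))) ?_).trans (Finset.card_insert_le _ _)
    intro p hp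
    simp only [Finset.mem_filter, Finset.mem_range, Finset.mem_insert, Finset.mem_Icc] at hp ⊢
    rcases hp.2.eq_two_or_odd with h | h
    · exact Or.inl h
    · exact Or.inr ⟨⟨hp.2.one_le, by omega⟩, hp.2, h⟩
  have hlog : ∀ᶠ x : ℝ in atTop, ‖Real.log x‖ ≤ (1 / 8) * ‖x ^ η‖ :=
    (isLittleO_log_rpow_atTop hη).bound (by norm_num)
  have hlog1 : ∀ᶠ x : ℝ in atTop, ‖Real.log x‖ ≤ (1 / 8) * ‖x‖ :=
    Real.isLittleO_log_id_atTop.bound (by norm_num)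
  have hcast := tendsto_natCast_atTop_atTop (R := ℝ)
  filter_upwards [hcast.eventually hlog, hcast.eventually hlog1, eventually_ge_atTop 8]
    with X h1 h2 hX
  have hX8 : (8 : ℝ) ≤ X := by exact_mod_cast hX
  have hX0 : (0 : ℝ) < X := by linarith
  have hl0 : 0 < Real.log X := Real.log_pos (by linarith)
  rw [Real.norm_of_nonneg hl0.le, Real.norm_of_nonneg (by positivity)] at h1 h2
  have hpi := Chebyshev.pi_ge X
  rw [div_le_iff₀ hl0] at hpi
  have hl2 : Real.log (X + 1) ≤ Real.log 2 + Real.log X := by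
    rw [← Real.log_mul two_ne_zero hX0.ne']
    exact Real.log_le_log (by positivity) (by linarith)
  have hc : (Nat.primeCounting X : ℝ) ≤
      ((Finset.Icc 1 X).filter (fun p => p.Prime ∧ p % 2 = 1)).card + 1 := by
    exact_mod_cast hcount X
  refine le_of_mul_le_mul_right ?_ hl0
  have hpow : (X : ℝ) ^ (1 - η) * Real.log X ≤ (1 / 8) * X := by
    calc (X : ℝ) ^ (1 - η) * Real.log X ≤ (X : ℝ) ^ (1 - η) * ((1 / 8) * (X : ℝ) ^ η) := by gcongr
      _ = (1 / 8) * ((X : ℝ) ^ (1 - η) * (X : ℝ) ^ η) := by ring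
      _ = (1 / 8) * X := by rw [← Real.rpow_add hX0]; simp
  have := Real.log_two_gt_d9
  have := Real.log_two_lt_d9
  have := mul_le_mul_of_nonneg_right hc hl0.le
  nlinarith

theorem card_filter_le_of_dyadic {P : ℕ → Prop} [DecidablePred P] {θ D : ℝ} (hθ : 0 < θ)
    (h : ∀ N : ℕ, (((Finset.Ioc (N / 2) N).filter P).card : ℝ) ≤ D * (N : ℝ) ^ θ) (N : ℕ) :
    (((Finset.Icc 1 N).filter P).card : ℝ) ≤ D / (1 - (2 : ℝ) ^ (-θ)) * (N : ℝ) ^ θ := by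
  have hq : 0 < 1 - (2 : ℝ) ^ (-θ) :=
    sub_pos.2 (Real.rpow_lt_one_of_one_lt_of_neg one_lt_two (neg_lt_zero.2 hθ))
  have hD : 0 ≤ D := by simpa using (Nat.cast_nonneg _).trans (h 1)
  induction N using Nat.strong_induction_on with
  | _ N ih =>
    rcases Nat.eq_zero_or_pos N with rfl | hN
    · simp [Real.zero_rpow hθ.ne']
    have hsub : (Finset.Icc 1 N).filter P ⊆
        (Finset.Icc 1 (N / 2)).filter P ∪ (Finset.Ioc (N / 2) N).filter P := by
      intro n hn
      simp only [Finset.mem_union, Finset.mem_filter, Finset.mem_Icc, Finset.mem_Ioc] at hn ⊢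
      have := hn.2
      by_cases hnN : n ≤ N / 2
      · exact Or.inl ⟨⟨hn.1.1, hnN⟩, this⟩
      · exact Or.inr ⟨⟨by omega, hn.1.2⟩, this⟩
    have hcard : (((Finset.Icc 1 N).filter P).card : ℝ) ≤
        ((Finset.Icc 1 (N / 2)).filter P).card + ((Finset.Ioc (N / 2) N).filter P).card := by
      exact_mod_cast (Finset.card_le_card hsub).trans (Finset.card_union_le _ _)
    calc (((Finset.Icc 1 N).filter P).card : ℝ)
        ≤ D / (1 - (2 : ℝ) ^ (-θ)) * ((N / 2 : ℕ) : ℝ) ^ θ + D * (N : ℝ) ^ θ :=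
          hcard.trans (add_le_add (ih _ (Nat.div_lt_self hN one_lt_two)) (h N))
      _ ≤ D / (1 - (2 : ℝ) ^ (-θ)) * ((N : ℝ) / 2) ^ θ + D * (N : ℝ) ^ θ := by
          gcongr
          exact Nat.cast_div_le
      _ = D / (1 - (2 : ℝ) ^ (-θ)) * (N : ℝ) ^ θ := by
          rw [Real.div_rpow (by positivity) zero_le_two, div_eq_mul_inv _ ((2 : ℝ) ^ θ),
            ← Real.rpow_neg zero_le_two]
          field_simp
          ring

theorem repSq16_of_sub {n p : ℕ} (hp : p.Prime) (hle : p ^ 5 ≤ n) (h : RepSq15 (n - p ^ 5)) :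
    RepSq16 n := by
  obtain ⟨q, f, hq, hf, hn⟩ := h
  refine ⟨q, Fin.cons p f, hq, Fin.cases hp hf, ?_⟩
  rw [Fin.sum_univ_succ]
  simp only [Fin.cons_zero, Fin.cons_succ]
  omega

open Filter in
theorem exists_fifth_root_approx :
    ∃ X : ℕ → ℕ, Tendsto X atTop atTop ∧ ∀ N, 2 ≤ N →
      X N ^ 5 ≤ N / 2 ∧ (N : ℝ) ^ ((1 : ℝ) / 5) ≤ 4 * X N := by
  refine ⟨fun N => ⌊((N / 2 : ℕ) : ℝ) ^ ((1 : ℝ) / 5)⌋₊, ?_, fun N hN => ?_⟩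
  · exact tendsto_nat_floor_atTop.comp ((tendsto_rpow_atTop (by norm_num)).comp
      (tendsto_natCast_atTop_atTop.comp (Nat.tendsto_div_const_atTop two_ne_zero)))
  · set M := N / 2 with hM
    set x : ℝ := (M : ℝ) ^ ((1 : ℝ) / 5) with hx
    have hM1 : (1 : ℝ) ≤ M := by exact_mod_cast (by omega : 1 ≤ M)
    have hx1 : 1 ≤ x := Real.one_le_rpow hM1 (by norm_num)
    have hx5 : x ^ 5 = M := by
      rw [hx, ← Real.rpow_natCast, ← Real.rpow_mul (by positivity)]
      norm_num
    have hfl : (⌊x⌋₊ : ℝ) ≤ x := Nat.floor_le (by positivity)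
    constructor
    · have : (⌊x⌋₊ : ℝ) ^ 5 ≤ M := hx5 ▸ pow_le_pow_left₀ (by positivity) hfl 5
      exact_mod_cast this
    · have h1 : (1 : ℝ) ≤ ⌊x⌋₊ := by exact_mod_cast Nat.le_floor (by simpa using hx1)
      have h2 : x ≤ 2 * ⌊x⌋₊ := by linarith [Nat.lt_floor_add_one x]
      have hNM : (N : ℝ) ≤ (2 * x) ^ 5 := by
        rw [mul_pow, hx5]
        exact_mod_cast (by omega : N ≤ 2 ^ 5 * M)
      calc (N : ℝ) ^ ((1 : ℝ) / 5) ≤ ((2 * x) ^ 5) ^ ((1 : ℝ) / 5) := by gcongr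
        _ = 2 * x := by
          rw [← Real.rpow_natCast, ← Real.rpow_mul (by positivity)]
          norm_num
        _ ≤ 4 * ⌊x⌋₊ := by linarith

theorem mul_le_two_mul_of_sq_le {z a e T : ℝ} (hz : 0 ≤ z) (ha : 0 < a)
    (hT : 2 * (e * T) ≤ a ^ 2) (h : (z * a) ^ 2 ≤ e * (z * a + T * z ^ 2)) (he : 0 ≤ e) :
    z * a ≤ 2 * e := by
  rcases hz.eq_or_lt with rfl | h0
  · simpa using he
  · refine le_of_mul_le_mul_left ?_ (mul_pos h0 ha)
    have := mul_le_mul_of_nonneg_right hT (sq_nonneg z)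
    linarith

open Filter in
theorem eventually_card_dyadic_le {C ε η : ℝ} (hη : 0 < η) (hηε : 2 * η ≤ ε)
    (hηδ : 4 * η < 27 / 3200) (hC : 0 < C)
    (hE : ∀ N : ℕ, (((Finset.Icc 1 N).filter (fun n => n % 2 = 0 ∧ ¬RepSq15 n)).card : ℝ) ≤
      C * (N : ℝ) ^ ((1 : ℝ) / 2 - 1 / 10 - 27 / 3200 + η)) :
    ∀ᶠ N : ℕ in atTop,
      (((Finset.Ioc (N / 2) N).filter (fun n => n % 2 = 1 ∧ ¬RepSq16 n)).card : ℝ) ≤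
        8 * C * (N : ℝ) ^ ((1 : ℝ) / 5 - 27 / 3200 + ε) := by
  obtain ⟨C', hC', hdiv⟩ := card_divisors_le_mul_rpow hη
  obtain ⟨X, hXtop, hX⟩ := exists_fifth_root_approx
  have hgap : ∀ᶠ N : ℕ in atTop, 32 * C * C' ≤ (N : ℝ) ^ (27 / 3200 - 4 * η) :=
    ((tendsto_rpow_atTop (sub_pos.2 hηδ)).comp tendsto_natCast_atTop_atTop).eventually_ge_atTop _
  filter_upwards [hgap, hXtop.eventually (eventually_rpow_le_card_odd_primes hη),
    hXtop.eventually (eventually_ge_atTop 1), eventually_ge_atTop 2] with N hgap hA hX1 hN2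
  obtain ⟨hX5, hNX⟩ := hX N hN2
  have hN1 : (1 : ℝ) ≤ N := by exact_mod_cast (by omega : 1 ≤ N)
  have hN0 : (0 : ℝ) < N := by linarith
  set A := (Finset.Icc 1 (X N)).filter (fun p => p.Prime ∧ p % 2 = 1) with hAdef
  set Z := (Finset.Ioc (N / 2) N).filter (fun n => n % 2 = 1 ∧ ¬RepSq16 n) with hZdef
  set E := (Finset.Icc 1 N).filter (fun n => n % 2 = 0 ∧ ¬RepSq15 n) with hEdef
  have hlt : ∀ n ∈ Z, ∀ p ∈ A, p ^ 5 < n := by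
    intro n hn p hp
    simp only [hZdef, hAdef, Finset.mem_filter, Finset.mem_Ioc, Finset.mem_Icc] at hn hp
    have := Nat.pow_le_pow_left hp.1.2 5
    omega
  have hmain := card_sq_mul_card_sq_le (k := 5) (T := ⌊C' * (N : ℝ) ^ η⌋₊) (Z := Z) (A := A)
    (E := E) (by norm_num) (fun n hn p hp => (hlt n hn p hp).le) (by
      intro n hn p hp
      have h5 := hlt n hn p hp
      simp only [hZdef, hAdef, hEdef, Finset.mem_filter, Finset.mem_Ioc, Finset.mem_Icc]
        at hn hp ⊢
      have hpar : p ^ 5 % 2 = 1 := Nat.odd_iff.1 ((Nat.odd_iff.2 hp.2.2).pow)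
      exact ⟨by omega, by omega, fun h => hn.2.2 (repSq16_of_sub hp.2.1 h5.le h)⟩) (by
      intro n hn h h0 hle
      refine Nat.le_floor ((hdiv h h0.ne').trans ?_)
      have : h ≤ N := hle.trans (Finset.mem_Ioc.1 (Finset.mem_filter.1 hn).1).2
      gcongr)
  have hA' : (N : ℝ) ^ ((1 : ℝ) / 5 - η) ≤ 4 * A.card := by
    have hX0 : (0 : ℝ) < X N := by exact_mod_cast hX1
    have hXN : (X N : ℝ) ≤ N := by
      exact_mod_cast (Nat.le_self_pow (by norm_num) _).trans (hX5.trans (Nat.div_le_self _ _))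
    calc (N : ℝ) ^ ((1 : ℝ) / 5 - η) = (N : ℝ) ^ ((1 : ℝ) / 5) * (N : ℝ) ^ (-η) := by
          rw [← Real.rpow_add hN0]; ring_nf
      _ ≤ 4 * X N * (X N : ℝ) ^ (-η) :=
          mul_le_mul hNX (Real.rpow_le_rpow_of_nonpos hX0 hXN (by linarith)) (by positivity)
            (by positivity)
      _ = 4 * (X N : ℝ) ^ (1 - η) := by
          rw [sub_eq_add_neg, Real.rpow_add hX0, Real.rpow_one]; ring
      _ ≤ 4 * A.card := by gcongr
  have hA0 : (0 : ℝ) < A.card := by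
    have : 0 < (N : ℝ) ^ ((1 : ℝ) / 5 - η) := by positivity
    linarith
  have hEN := hE N
  have hT : (⌊C' * (N : ℝ) ^ η⌋₊ : ℝ) ≤ C' * (N : ℝ) ^ η := Nat.floor_le (by positivity)
  have hET : 2 * ((E.card : ℝ) * ⌊C' * (N : ℝ) ^ η⌋₊) ≤ (A.card : ℝ) ^ 2 := by
    have hsq : ((N : ℝ) ^ ((1 : ℝ) / 5 - η)) ^ 2 ≤ (4 * A.card) ^ 2 := by gcongr
    have hexp : 32 * C * C' * ((N : ℝ) ^ ((1 : ℝ) / 2 - 1 / 10 - 27 / 3200 + η) * (N : ℝ) ^ η) ≤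
        ((N : ℝ) ^ ((1 : ℝ) / 5 - η)) ^ 2 := by
      calc _ ≤ (N : ℝ) ^ (27 / 3200 - 4 * η) *
            ((N : ℝ) ^ ((1 : ℝ) / 2 - 1 / 10 - 27 / 3200 + η) * (N : ℝ) ^ η) := by gcongr
        _ = _ := by
          rw [sq, ← Real.rpow_add hN0, ← Real.rpow_add hN0, ← Real.rpow_add hN0]
          ring_nf
    have := mul_le_mul hEN hT (by positivity) (by positivity)
    linarith
  have hZA : (Z.card : ℝ) * A.card ≤ 2 * E.card :=
    mul_le_two_mul_of_sq_le (Nat.cast_nonneg _) hA0 hET (by exact_mod_cast hmain)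
      (Nat.cast_nonneg _)
  refine le_of_mul_le_mul_right ?_ (show 0 < (N : ℝ) ^ ((1 : ℝ) / 5 - η) by positivity)
  calc (Z.card : ℝ) * (N : ℝ) ^ ((1 : ℝ) / 5 - η) ≤ Z.card * (4 * A.card) := by gcongr
    _ = 4 * (Z.card * A.card) := by ring
    _ ≤ 4 * (2 * E.card) := by gcongr
    _ ≤ 4 * (2 * (C * (N : ℝ) ^ ((1 : ℝ) / 2 - 1 / 10 - 27 / 3200 + η))) := by gcongr
    _ = 8 * C * (N : ℝ) ^ ((1 : ℝ) / 2 - 1 / 10 - 27 / 3200 + η) := by ring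
    _ ≤ 8 * C * (N : ℝ) ^ (((1 : ℝ) / 5 - 27 / 3200 + ε) + ((1 : ℝ) / 5 - η)) := by
        refine mul_le_mul_of_nonneg_left ?_ (by positivity)
        exact Real.rpow_le_rpow_of_exponent_le hN1 (by linarith)
    _ = _ := by rw [Real.rpow_add hN0]; ring

/-- Second step of the proof: adding one more prime fifth power. -/
theorem step_add_prime_fifth_power
    (hE₂ : ∀ ε : ℝ, 0 < ε → ∃ C : ℝ, 0 < C ∧ ∀ N : ℕ,
      (((Finset.Icc 1 N).filter (fun n => n % 2 = 0 ∧ ¬RepSq15 n)).card : ℝ) ≤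
        C * (N : ℝ) ^ ((1 : ℝ) / 2 - (1 : ℝ) / 10 - 27 / 3200 + ε)) :
    ∀ ε : ℝ, 0 < ε → ∃ C : ℝ, 0 < C ∧ ∀ N : ℕ,
      (((Finset.Icc 1 N).filter (fun n => n % 2 = 1 ∧ ¬RepSq16 n)).card : ℝ) ≤
        C * (N : ℝ) ^ ((1 : ℝ) / 5 - 27 / 3200 + ε) := by
  intro ε hε
  obtain ⟨η, hη, hηε, hηδ⟩ : ∃ η : ℝ, 0 < η ∧ 2 * η ≤ ε ∧ 4 * η < 27 / 3200 :=
    ⟨min (ε / 2) (1 / 1000), by positivity, by linarith [min_le_left (ε / 2) (1 / 1000)],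
      by linarith [min_le_right (ε / 2) (1 / 1000)]⟩
  obtain ⟨C, hC, hE⟩ := hE₂ η hη
  have hθ : 0 < (1 : ℝ) / 5 - 27 / 3200 + ε := by linarith
  have hlarge := eventually_card_dyadic_le hη hηε hηδ hC hE
  obtain ⟨N₀, hN₀⟩ := Filter.eventually_atTop.1 hlarge
  set D : ℝ := max (8 * C) N₀
  have hD : 0 < D := lt_max_of_lt_left (by positivity)
  have hq : 0 < 1 - (2 : ℝ) ^ (-((1 : ℝ) / 5 - 27 / 3200 + ε)) :=
    sub_pos.2 (Real.rpow_lt_one_of_one_lt_of_neg one_lt_two (neg_lt_zero.2 hθ))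
  refine ⟨_, div_pos hD hq, card_filter_le_of_dyadic hθ fun N => ?_⟩
  rcases le_or_gt N₀ N with hN | hN
  · exact (hN₀ N hN).trans (by gcongr; exact le_max_left _ _)
  · rcases Nat.eq_zero_or_pos N with rfl | hpos
    · rw [Nat.cast_zero, Real.zero_rpow hθ.ne']; simp
    have hcard : (((Finset.Ioc (N / 2) N).filter
        (fun n => n % 2 = 1 ∧ ¬RepSq16 n)).card : ℝ) ≤ N₀ := by
      have := (Finset.card_filter_le (Finset.Ioc (N / 2) N)
        (fun n => n % 2 = 1 ∧ ¬RepSq16 n)).trans_eq (Nat.card_Ioc _ _)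
      exact_mod_cast this.trans (by omega)
    have h1 : 1 ≤ (N : ℝ) ^ ((1 : ℝ) / 5 - 27 / 3200 + ε) :=
      Real.one_le_rpow (by exact_mod_cast hpos) hθ.le
    calc _ ≤ D := hcard.trans (le_max_right _ _)
      _ ≤ D * _ := le_mul_of_one_le_right hD.le h1
end
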